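/- (Expurgation lemma.) Let 𝒰, 𝒳, 𝒴, 𝒵 be nonempty finite sets, 𝒲 a nonempty finite set of channels from 𝒳 to 𝒴, 𝒱 a nonempty finite set of channels from 𝒳 to 𝒵, and (Φ,ψ) a random encoding code with message set 𝒰, random encoder Φ : 𝒰 → (distributions on 𝒳), and deterministic decoder ψ : 𝒴 → 𝒰. Assume there are reals λ, μ > 0 and δ > 0 such that: (a) Σ_{u∈𝒰} |𝒰|⁻¹·W(ψ(Y)≠u|Φ(u)) ≤ λ for every W ∈ 𝒲; (b) I(U;Z(V,U)) ≤ μ for the uniform message U and every V ∈ 𝒱; and (c) D_V(u) := KL( Z(V,u) ‖ |𝒰|⁻¹·Σ_{v∈𝒰} Z(V,v) ) ≤ δ for every u ∈ 𝒰 and V ∈ 𝒱 (KL divergence and mutual information in natural logarithm). Suppose positive integers J, K and positive reals A, B satisfy β := J·K/|𝒰| < 1/4, K·μ ≤ A/4, K·λ ≤ B/4, |𝒱|·J·exp(−A/(4δ)) < 1/4, |𝒲|·J·exp(−B/4) < 1/4, and J·exp(−K·β/32) < 1/4. Then there exist a random encoder Υ : {1,…,J} → (distributions on 𝒳) and a deterministic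 decoder ν : 𝒴 → {1,…,J} such that for every W ∈ 𝒲 and every j ∈ {1,…,J}, W(ν(Y)≠j|Υ(j)) ≤ B/(K·(1 − 3β/2)), and for every probability distribution of a message Ũ on {1,…,J} and every V ∈ 𝒱, I(Ũ; Z̃(V,Ũ)) ≤ A/(K·(1 − 3β/2)), where Z̃(V,j) is the output distribution of V on the encoding Υ(j). -/

import Mathlib

open scoped BigOperators

noncomputable section

/-- A probability distribution on a finite type. -/
def IsProbDist {α : Type} [Fintype α] (p : α → ℝ) : Prop :=
  (∀ a, 0 ≤ p a) ∧ (∑ a, p a) = 1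

/-- A channel (stochastic matrix) from `α` to `β`. -/
def IsChannel {α β : Type} [Fintype β] (W : α → β → ℝ) : Prop :=
  ∀ a, IsProbDist (W a)

/-- Output distribution of channel `V` under random encoder `Φ` on message `u`. -/
def Zout {U X Z : Type} [Fintype X] (Φ : U → X → ℝ) (V : X → Z → ℝ) (u : U) (z : Z) : ℝ :=
  ∑ x, Φ u x * V x z

/-- Probability that the decoder `ψ` fails on message `u`. -/
def errProb {U X Y : Type} [Fintype X] [Fintype Y] [DecidableEq U]
    (W : X → Y → ℝ) (Φ : U → X → ℝ) (ψ : Y → U) (u : U) : ℝ :=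
  ∑ y, (if ψ y ≠ u then Zout Φ W u y else 0)

/-- Shannon mutual information (natural logarithm) of the joint law `p u * q u z`. -/
def mutualInfo {U Z : Type} [Fintype U] [Fintype Z] (p : U → ℝ) (q : U → Z → ℝ) : ℝ :=
  ∑ u, ∑ z, p u * q u z * Real.log (q u z / (∑ v, p v * q v z))

/-- Kullback–Leibler divergence (natural logarithm) between distributions on a finite set. -/
def KLdiv {Z : Type} [Fintype Z] (p q : Z → ℝ) : ℝ :=
  ∑ z, p z * Real.log (p z / q z)

section Entropy

/-- The Gibbs inequality. -/
lemma KLdiv_nonneg {Z : Type} [Fintype Z] {p q : Z → ℝ} (hp : IsProbDist p) (hq : IsProbDist q)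
    (hpq : ∀ z, q z = 0 → p z = 0) : 0 ≤ KLdiv p q := by
  have key : ∀ z, p z - q z ≤ p z * Real.log (p z / q z) := by
    intro z
    rcases (hp.1 z).eq_or_lt with h0 | h0
    · simp [← h0, hq.1 z]
    · have hqz : 0 < q z := (hq.1 z).lt_of_ne fun h => h0.ne' (hpq z h.symm)
      have h := Real.one_sub_inv_le_log_of_pos (div_pos h0 hqz)
      calc p z - q z = p z * (1 - (p z / q z)⁻¹) := by field_simp
        _ ≤ _ := mul_le_mul_of_nonneg_left h h0.le
  calc (0 : ℝ) = ∑ z, (p z - q z) := by rw [Finset.sum_sub_distrib, hp.2, hq.2, sub_self]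
    _ ≤ _ := Finset.sum_le_sum fun z _ => key z

lemma IsProbDist.mix {ι Z : Type} [Fintype ι] [Fintype Z] {w : ι → ℝ} {P : ι → Z → ℝ}
    (hw : IsProbDist w) (hP : ∀ i, IsProbDist (P i)) :
    IsProbDist (fun z => ∑ i, w i * P i z) := by
  refine ⟨fun z => Finset.sum_nonneg fun i _ => mul_nonneg (hw.1 i) ((hP i).1 z), ?_⟩
  rw [Finset.sum_comm]
  simp_rw [← Finset.mul_sum, (hP _).2, mul_one, hw.2]

lemma mutualInfo_eq_sum_KLdiv {ι Z : Type} [Fintype ι] [Fintype Z] (w : ι → ℝ)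
    (P : ι → Z → ℝ) :
    mutualInfo w P = ∑ i, w i * KLdiv (P i) (fun z => ∑ v, w v * P v z) := by
  simp only [mutualInfo, KLdiv, Finset.mul_sum, mul_assoc]

lemma mix_eq_zero {ι Z : Type} [Fintype ι] [Fintype Z] {w : ι → ℝ} {P : ι → Z → ℝ}
    (hw : IsProbDist w) (hP : ∀ i, IsProbDist (P i)) {z : Z} (h : ∑ v, w v * P v z = 0)
    (i : ι) : w i * P i z = 0 :=
  (Finset.sum_eq_zero_iff_of_nonneg
    fun v _ => mul_nonneg (hw.1 v) ((hP v).1 z)).1 h i (Finset.mem_univ i)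

lemma mutualInfo_nonneg {ι Z : Type} [Fintype ι] [Fintype Z] {w : ι → ℝ} {P : ι → Z → ℝ}
    (hw : IsProbDist w) (hP : ∀ i, IsProbDist (P i)) : 0 ≤ mutualInfo w P := by
  rw [mutualInfo_eq_sum_KLdiv]
  refine Finset.sum_nonneg fun i _ => ?_
  rcases (hw.1 i).eq_or_lt with h0 | h0
  · simp [← h0]
  · refine mul_nonneg h0.le (KLdiv_nonneg (hP i) (hw.mix hP) fun z hz => ?_)
    exact (mul_eq_zero.1 (mix_eq_zero hw hP hz i)).resolve_left h0.ne'

/-- The compensation identity for the Kullback–Leibler divergence. -/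
lemma sum_mul_KLdiv {ι Z : Type} [Fintype ι] [Fintype Z] {w : ι → ℝ} {P : ι → Z → ℝ}
    {Q : Z → ℝ} (hw : IsProbDist w) (hP : ∀ i, IsProbDist (P i))
    (hPQ : ∀ i z, Q z = 0 → P i z = 0) :
    ∑ i, w i * KLdiv (P i) Q = mutualInfo w P + KLdiv (fun z => ∑ i, w i * P i z) Q := by
  simp only [mutualInfo, KLdiv, Finset.mul_sum, Finset.sum_mul]
  rw [Finset.sum_comm (s := (Finset.univ : Finset Z)), ← Finset.sum_add_distrib]
  refine Finset.sum_congr rfl fun i _ => ?_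
  rw [← Finset.sum_add_distrib]
  refine Finset.sum_congr rfl fun z _ => ?_
  by_cases h : w i * P i z = 0
  · rw [← mul_assoc, h]; simp
  · have hPi : P i z ≠ 0 := fun h' => h (by simp [h'])
    have hQ : Q z ≠ 0 := fun h' => hPi (hPQ i z h')
    have hM : ∑ v, w v * P v z ≠ 0 := fun h' => h (mix_eq_zero hw hP h' i)
    rw [Real.log_div hPi hQ, Real.log_div hPi hM, Real.log_div hM hQ]
    ring

lemma KLdiv_mix_le {ι Z : Type} [Fintype ι] [Fintype Z] {w : ι → ℝ} {P : ι → Z → ℝ}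
    {Q : Z → ℝ} (hw : IsProbDist w) (hP : ∀ i, IsProbDist (P i))
    (hPQ : ∀ i z, Q z = 0 → P i z = 0) :
    KLdiv (fun z => ∑ i, w i * P i z) Q ≤ ∑ i, w i * KLdiv (P i) Q := by
  rw [sum_mul_KLdiv hw hP hPQ]
  linarith [mutualInfo_nonneg hw hP]

lemma mutualInfo_le_of_KLdiv_le {ι Z : Type} [Fintype ι] [Fintype Z] {w : ι → ℝ}
    {P : ι → Z → ℝ} {Q : Z → ℝ} {c : ℝ} (hw : IsProbDist w) (hP : ∀ i, IsProbDist (P i))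
    (hQ : IsProbDist Q) (hPQ : ∀ i z, Q z = 0 → P i z = 0) (hc : ∀ i, KLdiv (P i) Q ≤ c) :
    mutualInfo w P ≤ c := by
  have h1 := sum_mul_KLdiv hw hP hPQ
  have h2 : 0 ≤ KLdiv (fun z => ∑ i, w i * P i z) Q :=
    KLdiv_nonneg (hw.mix hP) hQ fun z hz => by simp [hPQ _ z hz]
  have h3 : ∑ i, w i * KLdiv (P i) Q ≤ ∑ i, w i * c :=
    Finset.sum_le_sum fun i _ => mul_le_mul_of_nonneg_left (hc i) (hw.1 i)
  rw [← Finset.sum_mul, hw.2, one_mul] at h3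
  linarith

end Entropy

section Coding

variable {U X Y Z : Type} [Fintype X] [Fintype Y]

lemma isProbDist_Zout [Fintype Z] {Φ : U → X → ℝ} {V : X → Z → ℝ} (hΦ : ∀ u, IsProbDist (Φ u))
    (hV : IsChannel V) (u : U) : IsProbDist (Zout Φ V u) :=
  (hΦ u).mix hV

lemma Zout_mix {ι κ : Type} [Fintype κ] (w : ι → κ → ℝ) (G : ι → κ → U) (Φ : U → X → ℝ)
    (V : X → Z → ℝ) (j : ι) :
    Zout (fun j x => ∑ k, w j k * Φ (G j k) x) V j
      = fun z => ∑ k, w j k * Zout Φ V (G j k) z := by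
  funext z
  simp only [Zout, Finset.sum_mul, Finset.mul_sum, mul_assoc]
  exact Finset.sum_comm

lemma errProb_nonneg [DecidableEq U] {Φ : U → X → ℝ} {W : X → Y → ℝ}
    (hΦ : ∀ u, IsProbDist (Φ u)) (hW : IsChannel W) (ψ : Y → U) (u : U) :
    0 ≤ errProb W Φ ψ u :=
  Finset.sum_nonneg fun y _ => by
    have := (isProbDist_Zout hΦ hW u).1 y
    split_ifs <;> simp [this]

lemma errProb_le_one [DecidableEq U] {Φ : U → X → ℝ} {W : X → Y → ℝ}
    (hΦ : ∀ u, IsProbDist (Φ u)) (hW : IsChannel W) (ψ : Y → U) (u : U) :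
    errProb W Φ ψ u ≤ 1 := by
  rw [← (isProbDist_Zout hΦ hW u).2]
  refine Finset.sum_le_sum fun y _ => ?_
  have := (isProbDist_Zout hΦ hW u).1 y
  split_ifs <;> simp [this]

lemma errProb_mix_le [DecidableEq U] {ι κ : Type} [DecidableEq ι] [Fintype κ]
    {w : ι → κ → ℝ} {G : ι → κ → U} {Φ : U → X → ℝ} {W : X → Y → ℝ}
    {ψ : Y → U} {ν : Y → ι} (hΦ : ∀ u, IsProbDist (Φ u)) (hW : IsChannel W) {j : ι}
    (hw : ∀ k, 0 ≤ w j k) (hν : ∀ k y, w j k ≠ 0 → ψ y = G j k → ν y = j) :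
    errProb W (fun j x => ∑ k, w j k * Φ (G j k) x) ν j
      ≤ ∑ k, w j k * errProb W Φ ψ (G j k) := by
  simp only [errProb, Finset.mul_sum, Zout_mix]
  rw [Finset.sum_comm]
  refine Finset.sum_le_sum fun y _ => ?_
  have h0 : ∀ k, 0 ≤ Zout Φ W (G j k) y := fun k => (isProbDist_Zout hΦ hW _).1 y
  split_ifs with h
  · refine Finset.sum_le_sum fun k _ => ?_
    by_cases hk : w j k = 0
    · simp [hk]
    · rw [if_pos fun h' => h (hν k y hk h')]
  · refine Finset.sum_nonneg fun k _ => mul_nonneg (hw k) ?_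
    split_ifs <;> simp [h0]

end Coding

section Counting

/-- A union bound in counting form. -/
lemma exists_forall_not_of_card_le {I Ω : Type} [Fintype I] [Fintype Ω] [Nonempty Ω]
    (P : I → Ω → Prop) [∀ i, DecidablePred (P i)] (q : I → ℝ)
    (h : ∀ i, ((Finset.univ.filter (P i)).card : ℝ) ≤ q i * Fintype.card Ω)
    (hq : ∑ i, q i < 1) : ∃ ω, ∀ i, ¬ P i ω := by
  classical
  by_contra! hcon
  have hsub : (Finset.univ : Finset Ω) ⊆ Finset.univ.biUnion fun i => Finset.univ.filter (P i) := by
    intro ω _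
    obtain ⟨i, hi⟩ := hcon ω
    simp only [Finset.mem_biUnion, Finset.mem_filter, Finset.mem_univ, true_and]
    exact ⟨i, hi⟩
  have h1 : (Fintype.card Ω : ℝ) ≤ ∑ i, ((Finset.univ.filter (P i)).card : ℝ) := by
    exact_mod_cast (Finset.card_le_card hsub).trans Finset.card_biUnion_le
  have h2 : ∑ i, ((Finset.univ.filter (P i)).card : ℝ) ≤ (∑ i, q i) * Fintype.card Ω := by
    rw [Finset.sum_mul]
    exact Finset.sum_le_sum fun i _ => h i
  have h3 : (0 : ℝ) < Fintype.card Ω := by exact_mod_cast Fintype.card_pos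
  nlinarith

/-- A bound on the conditional frequency of `P` given all coordinates but `j` bounds the
frequency of `P`. -/
lemma card_filter_le_of_forall_split {ι β : Type} [Fintype ι] [DecidableEq ι] [Fintype β]
    (j : ι) (P : (ι → β) → Prop) [DecidablePred P] (q : ℝ)
    (h : ∀ r : {i // i ≠ j} → β,
      ((Finset.univ.filter fun x => P ((Equiv.funSplitAt j β).symm (x, r))).card : ℝ)
        ≤ q * Fintype.card β) :
    ((Finset.univ.filter P).card : ℝ) ≤ q * Fintype.card (ι → β) := by
  have e := Fintype.card_congr (Equiv.funSplitAt j β)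
  rw [Fintype.card_prod] at e
  have h1 : ((Finset.univ.filter P).card : ℝ)
      = ∑ r : {i // i ≠ j} → β,
        ((Finset.univ.filter fun x => P ((Equiv.funSplitAt j β).symm (x, r))).card : ℝ) := by
    simp only [Finset.card_filter, Nat.cast_sum]
    rw [← (Equiv.funSplitAt j β).symm.sum_comp, Fintype.sum_prod_type_right]
  rw [h1, e]
  refine (Finset.sum_le_sum fun r _ => h r).trans ?_
  rw [Finset.sum_const, nsmul_eq_mul, Finset.card_univ]
  push_cast
  exact le_of_eq (by ring)

lemma card_filter_apply_le {ι β : Type} [Fintype ι] [DecidableEq ι] [Fintype β]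
    (j : ι) (P : β → Prop) [DecidablePred P] (q : ℝ)
    (h : ((Finset.univ.filter P).card : ℝ) ≤ q * Fintype.card β) :
    ((Finset.univ.filter fun G : ι → β => P (G j)).card : ℝ) ≤ q * Fintype.card (ι → β) := by
  refine card_filter_le_of_forall_split j _ q fun r => ?_
  simpa [Equiv.funSplitAt_symm_apply] using h

lemma exp_mul_le_one_add {s x : ℝ} (h0 : 0 ≤ x) (h1 : x ≤ 1) :
    Real.exp (s * x) ≤ 1 + x * (Real.exp s - 1) := by
  have h := convexOn_exp.2 (Set.mem_univ 0) (Set.mem_univ s) (sub_nonneg.2 h1) h0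
    (sub_add_cancel 1 x)
  simp only [smul_eq_mul, mul_zero, zero_add, Real.exp_zero, mul_one] at h
  rw [mul_comm s x]
  linarith

/-- The Chernoff bound for independent uniform samples, in counting form. -/
lemma card_filter_lt_sum_le {U : Type} [Fintype U] (K : ℕ) {f : U → ℝ}
    (f0 : ∀ u, 0 ≤ f u) (f1 : ∀ u, f u ≤ 1) {m s t : ℝ} (hs : 0 ≤ s)
    (hm : ∑ u, f u ≤ Fintype.card U * m) :
    ((Finset.univ.filter fun g : Fin K → U => t < ∑ k, f (g k)).card : ℝ)
      ≤ Real.exp (K * m * (Real.exp s - 1) - s * t) * Fintype.card (Fin K → U) := by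
  have hE : 0 ≤ Real.exp s - 1 := by linarith [Real.one_le_exp hs]
  have h1 : ∑ u, Real.exp (s * f u) ≤ Fintype.card U * Real.exp (m * (Real.exp s - 1)) := by
    calc ∑ u, Real.exp (s * f u) ≤ ∑ u, (1 + f u * (Real.exp s - 1)) :=
          Finset.sum_le_sum fun u _ => exp_mul_le_one_add (f0 u) (f1 u)
      _ = Fintype.card U + (∑ u, f u) * (Real.exp s - 1) := by
          rw [Finset.sum_add_distrib, Finset.sum_mul]; simp
      _ ≤ Fintype.card U * (m * (Real.exp s - 1) + 1) := by nlinarith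
      _ ≤ _ := mul_le_mul_of_nonneg_left (Real.add_one_le_exp _) (Nat.cast_nonneg _)
  have h2 : ∑ g : Fin K → U, Real.exp (s * ∑ k, f (g k))
      ≤ (Fintype.card U * Real.exp (m * (Real.exp s - 1))) ^ K := by
    calc _ = (∑ u, Real.exp (s * f u)) ^ K := by
          rw [Fintype.sum_pow]
          simp only [Finset.mul_sum, Real.exp_sum]
      _ ≤ _ := pow_le_pow_left₀ (Finset.sum_nonneg fun u _ => (Real.exp_pos _).le) h1 K
  have h3 : ((Finset.univ.filter fun g : Fin K → U => t < ∑ k, f (g k)).card : ℝ)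
      ≤ Real.exp (-(s * t)) * ∑ g : Fin K → U, Real.exp (s * ∑ k, f (g k)) := by
    rw [Finset.card_filter, Nat.cast_sum, Finset.mul_sum]
    refine Finset.sum_le_sum fun g _ => ?_
    rw [← Real.exp_add]
    split_ifs with h
    · have : s * t ≤ s * ∑ k, f (g k) := mul_le_mul_of_nonneg_left h.le hs
      rw [Nat.cast_one]
      exact Real.one_le_exp (by linarith)
    · simpa using (Real.exp_pos _).le
  refine h3.trans ((mul_le_mul_of_nonneg_left h2 (Real.exp_pos _).le).trans (le_of_eq ?_))
  rw [mul_pow, ← Real.exp_nat_mul, Fintype.card_fun, Fintype.card_fin,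
    show K * m * (Real.exp s - 1) - s * t = -(s * t) + K * (m * (Real.exp s - 1)) by ring,
    Real.exp_add]
  push_cast
  ring

/-- The Chernoff bound for a sum exceeding four times its mean. -/
lemma card_filter_lt_sum_le_of_mean_le {U : Type} [Fintype U] [Nonempty U] (K : ℕ) {f : U → ℝ}
    {m d t : ℝ} (hd : 0 < d) (ht : 0 ≤ t) (f0 : ∀ u, 0 ≤ f u) (f1 : ∀ u, f u ≤ d)
    (hm : ∑ u, (Fintype.card U : ℝ)⁻¹ * f u ≤ m) (hKm : K * m ≤ t / 4) :
    ((Finset.univ.filter fun g : Fin K → U => t < ∑ k, f (g k)).card : ℝ)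
      ≤ Real.exp (-(t / (4 * d))) * Fintype.card (Fin K → U) := by
  have hN : (0 : ℝ) < Fintype.card U := by exact_mod_cast Fintype.card_pos
  have h := card_filter_lt_sum_le K (f := fun u => f u / d) (m := m / d) (s := 1) (t := t / d)
    (fun u => div_nonneg (f0 u) hd.le) (fun u => (div_le_one hd).2 (f1 u)) zero_le_one (by
      rw [← Finset.mul_sum, inv_mul_le_iff₀ hN] at hm
      rw [← Finset.sum_div, ← mul_div_assoc]
      gcongr)
  have hiff : ∀ g : Fin K → U, t / d < ∑ k, f (g k) / d ↔ t < ∑ k, f (g k) := fun g => by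
    rw [← Finset.sum_div, div_lt_div_iff_of_pos_right hd]
  simp only [hiff] at h
  refine h.trans (mul_le_mul_of_nonneg_right (Real.exp_le_exp.2 ?_) (Nat.cast_nonneg _))
  have h4 : K * (m / d) ≤ t / d / 4 := by
    rw [← mul_div_assoc, div_right_comm]
    gcongr
  have hE1 : Real.exp 1 - 1 ≤ 3 := by linarith [Real.exp_one_lt_d9]
  have hE0 : 0 ≤ Real.exp 1 - 1 := by linarith [Real.one_le_exp zero_le_one]
  have h5 : t / (4 * d) = t / d / 4 := by field_simp
  have h6 : 0 ≤ t / d := div_nonneg ht hd.le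
  rw [h5]
  nlinarith [mul_le_mul_of_nonneg_right h4 hE0, mul_le_mul_of_nonneg_left hE1 h6]

/-- The Chernoff bound for the number of samples falling into a set of density at most `b`. -/
lemma card_filter_lt_card_mem_le {U : Type} [Fintype U] [DecidableEq U] (K : ℕ)
    (S : Finset U) {b : ℝ} (hb : 0 ≤ b) (hS : (S.card : ℝ) ≤ Fintype.card U * b) :
    ((Finset.univ.filter fun g : Fin K → U =>
        K * (3 * b / 2) < ((Finset.univ.filter fun k => g k ∈ S).card : ℝ)).card : ℝ)
      ≤ Real.exp (-(K * b / 32)) * Fintype.card (Fin K → U) := by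
  have h := card_filter_lt_sum_le K (f := fun u => if u ∈ S then (1 : ℝ) else 0) (m := b)
    (s := 1 / 4) (t := K * (3 * b / 2)) (fun u => by split_ifs <;> simp)
    (fun u => by split_ifs <;> simp) (by norm_num) (by simpa using hS)
  simp only [Finset.sum_boole] at h
  refine h.trans (mul_le_mul_of_nonneg_right (Real.exp_le_exp.2 ?_) (Nat.cast_nonneg _))
  have hE : Real.exp (1 / 4) - 1 ≤ 1 / 3 := by
    have := Real.exp_bound_div_one_sub_of_interval (x := 1 / 4) (by norm_num) (by norm_num)
    norm_num at this ⊢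
    linarith
  have hKb : 0 ≤ K * b := mul_nonneg (Nat.cast_nonneg _) hb
  nlinarith [mul_le_mul_of_nonneg_left hE hKb]

/-- The indices `k` of row `j` whose entry occurs in another row. -/
def collisions {ι κ U : Type} [Fintype ι] [Fintype κ] [DecidableEq ι] [DecidableEq U]
    (G : ι → κ → U) (j : ι) : Finset κ :=
  Finset.univ.filter fun k => ∃ j', j' ≠ j ∧ ∃ k', G j' k' = G j k

lemma card_filter_lt_card_collisions_le {U : Type} [Fintype U] [DecidableEq U] {J K : ℕ}
    {b : ℝ} (hb : 0 ≤ b) (hJK : (J : ℝ) * K ≤ Fintype.card U * b) (j : Fin J) :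
    ((Finset.univ.filter fun G : Fin J → Fin K → U =>
        K * (3 * b / 2) < ((collisions G j).card : ℝ)).card : ℝ)
      ≤ Real.exp (-(K * b / 32)) * Fintype.card (Fin J → Fin K → U) := by
  refine card_filter_le_of_forall_split j _ _ fun r => ?_
  let S : Finset U := Finset.univ.image fun a : {i // i ≠ j} × Fin K => r a.1 a.2
  have hS : (S.card : ℝ) ≤ Fintype.card U * b := by
    refine le_trans ?_ hJK
    have h1 : S.card ≤ Fintype.card ({i // i ≠ j} × Fin K) := Finset.card_image_le
    have h2 : Fintype.card {i // i ≠ j} ≤ J := by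
      simpa only [Fintype.card_fin] using Fintype.card_subtype_le fun i : Fin J => i ≠ j
    rw [Fintype.card_prod, Fintype.card_fin] at h1
    exact_mod_cast h1.trans (Nat.mul_le_mul_right K h2)
  have hcol : ∀ x : Fin K → U, collisions ((Equiv.funSplitAt j (Fin K → U)).symm (x, r)) j
      = Finset.univ.filter fun k => x k ∈ S := by
    intro x
    ext k
    simp only [collisions, S, Finset.mem_filter, Finset.mem_univ, true_and, Finset.mem_image,
      Prod.exists, Subtype.exists, Equiv.funSplitAt_symm_apply, dite_true]
    constructor
    · rintro ⟨j', hj', k', h⟩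
      exact ⟨j', hj', k', by simpa [hj'] using h⟩
    · rintro ⟨j', hj', k', h⟩
      exact ⟨j', hj', k', by simpa [hj'] using h⟩
  simp only [hcol]
  exact card_filter_lt_card_mem_le K S hb hS

end Counting

/-- **Expurgation lemma.** From a random encoding code with average error at
most `λ` (for every main channel), strong secrecy leakage at most `μ` (for every wiretap
channel) and uniformly bounded divergences `D_V(u) ≤ δ`, one can extract, under the stated
counting conditions on `J`, `K`, `A`, `B`, `β`, a random encoding code with message set
`{1,…,J}` whose maximal error is at most `B/(K(1−3β/2))` for every main channel and whose
mutual-information leakage is at most `A/(K(1−3β/2))` for every wiretap channel and every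
message distribution. -/
theorem expurgation_lemma
    (U X Y Z SW SV : Type)
    [Fintype U] [Fintype X] [Fintype Y] [Fintype Z] [Fintype SW] [Fintype SV]
    [Nonempty U] [Nonempty X] [Nonempty Y] [Nonempty Z] [Nonempty SW] [Nonempty SV]
    [DecidableEq U]
    (Wfam : SW → X → Y → ℝ) (Vfam : SV → X → Z → ℝ)
    (hWchan : ∀ s, IsChannel (Wfam s)) (hVchan : ∀ s, IsChannel (Vfam s))
    (Φ : U → X → ℝ) (hΦ : ∀ u, IsProbDist (Φ u)) (ψ : Y → U)
    (lam mu δ : ℝ) (hlam : 0 < lam) (hmu : 0 < mu) (hδ : 0 < δ)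
    -- (a) average error at most `λ` for every main channel
    (ha : ∀ s : SW, (∑ u, (Fintype.card U : ℝ)⁻¹ * errProb (Wfam s) Φ ψ u) ≤ lam)
    -- (b) leakage at most `μ` for the uniform message and every wiretap channel
    (hb : ∀ s : SV,
      mutualInfo (fun _ : U => (Fintype.card U : ℝ)⁻¹) (fun u => Zout Φ (Vfam s) u) ≤ mu)
    -- (c) `D_V(u) ≤ δ` for every message and every wiretap channel
    (hc : ∀ (u : U) (s : SV),
      KLdiv (Zout Φ (Vfam s) u)
        (fun z => (Fintype.card U : ℝ)⁻¹ * ∑ v, Zout Φ (Vfam s) v z) ≤ δ)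
    (J K : ℕ) (hJ : 0 < J) (hK : 0 < K) (A B : ℝ) (hA : 0 < A) (hB : 0 < B)
    (β : ℝ) (hβ : β = (J : ℝ) * K / (Fintype.card U : ℝ)) (hβ4 : β < 1/4)
    (hKmu : (K : ℝ) * mu ≤ A / 4) (hKlam : (K : ℝ) * lam ≤ B / 4)
    (hV4 : (Fintype.card SV : ℝ) * J * Real.exp (-(A / (4 * δ))) < 1/4)
    (hW4 : (Fintype.card SW : ℝ) * J * Real.exp (-(B / 4)) < 1/4)
    (hJ4 : (J : ℝ) * Real.exp (-((K : ℝ) * β / 32)) < 1/4) :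
    ∃ (Υ : Fin J → X → ℝ) (ν : Y → Fin J),
      (∀ j, IsProbDist (Υ j)) ∧
      (∀ (s : SW) (j : Fin J),
        errProb (Wfam s) Υ ν j ≤ B / ((K : ℝ) * (1 - 3 * β / 2))) ∧
      (∀ (s : SV) (p : Fin J → ℝ), IsProbDist p →
        mutualInfo p (fun j => Zout Υ (Vfam s) j) ≤ A / ((K : ℝ) * (1 - 3 * β / 2))) := by
  classical
  have hN : (0 : ℝ) < Fintype.card U := by exact_mod_cast Fintype.card_pos
  have hK' : (0 : ℝ) < K := by exact_mod_cast hK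
  have hβ0 : 0 ≤ β := hβ ▸ by positivity
  set Q : SV → Z → ℝ := fun s z => (Fintype.card U : ℝ)⁻¹ * ∑ v, Zout Φ (Vfam s) v z with hQdef
  have hZ : ∀ s u, IsProbDist (Zout Φ (Vfam s) u) := fun s => isProbDist_Zout hΦ (hVchan s)
  have hunif : IsProbDist fun _ : U => (Fintype.card U : ℝ)⁻¹ :=
    ⟨fun _ => by positivity, by simp [hN.ne']⟩
  have hQmix : ∀ s, Q s = fun z => ∑ v, (Fintype.card U : ℝ)⁻¹ * Zout Φ (Vfam s) v z :=
    fun s => funext fun z => Finset.mul_sum _ _ _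
  have hQ : ∀ s, IsProbDist (Q s) := fun s => hQmix s ▸ hunif.mix (hZ s)
  have hac : ∀ s u z, Q s z = 0 → Zout Φ (Vfam s) u z = 0 := by
    intro s u z h
    rw [hQmix] at h
    exact (mul_eq_zero.1 (mix_eq_zero hunif (hZ s) h u)).resolve_left (inv_ne_zero hN.ne')
  have hD0 : ∀ s u, 0 ≤ KLdiv (Zout Φ (Vfam s) u) (Q s) := fun s u =>
    KLdiv_nonneg (hZ s u) (hQ s) (hac s u)
  let P : Fin J × (SV ⊕ SW ⊕ Unit) → (Fin J → Fin K → U) → Prop := fun i G =>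
    match i.2 with
    | .inl s => A < ∑ k, KLdiv (Zout Φ (Vfam s) (G i.1 k)) (Q s)
    | .inr (.inl s) => B < ∑ k, errProb (Wfam s) Φ ψ (G i.1 k)
    | .inr (.inr _) => K * (3 * β / 2) < ((collisions G i.1).card : ℝ)
  let q : Fin J × (SV ⊕ SW ⊕ Unit) → ℝ := fun i =>
    match i.2 with
    | .inl _ => Real.exp (-(A / (4 * δ)))
    | .inr (.inl _) => Real.exp (-(B / 4))
    | .inr (.inr _) => Real.exp (-((K : ℝ) * β / 32))
  have hPV : ∀ s, ((Finset.univ.filter fun g : Fin K → U =>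
      A < ∑ k, KLdiv (Zout Φ (Vfam s) (g k)) (Q s)).card : ℝ)
        ≤ Real.exp (-(A / (4 * δ))) * Fintype.card (Fin K → U) := fun s => by
    have hm : ∑ u, (Fintype.card U : ℝ)⁻¹ * KLdiv (Zout Φ (Vfam s) u) (Q s) ≤ mu := by
      rw [hQmix, ← mutualInfo_eq_sum_KLdiv]
      exact hb s
    exact card_filter_lt_sum_le_of_mean_le (f := fun u => KLdiv (Zout Φ (Vfam s) u) (Q s))
      K hδ hA.le (hD0 s) (fun u => hc u s) hm hKmu
  have hPW : ∀ s, ((Finset.univ.filter fun g : Fin K → U =>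
      B < ∑ k, errProb (Wfam s) Φ ψ (g k)).card : ℝ)
        ≤ Real.exp (-(B / 4)) * Fintype.card (Fin K → U) := fun s => by
    have := card_filter_lt_sum_le_of_mean_le (f := errProb (Wfam s) Φ ψ) K one_pos hB.le
      (errProb_nonneg hΦ (hWchan s) ψ) (errProb_le_one hΦ (hWchan s) ψ) (ha s) hKlam
    rwa [mul_one] at this
  have hJK : (J : ℝ) * K ≤ Fintype.card U * β := by rw [hβ, mul_div_cancel₀ _ hN.ne']
  obtain ⟨G, hG⟩ : ∃ G, ∀ i, ¬ P i G := by
    refine exists_forall_not_of_card_le P q ?_ ?_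
    · rintro ⟨j, s | s | s⟩
      · convert card_filter_apply_le j _ _ (hPV s)
      · convert card_filter_apply_le j _ _ (hPW s)
      · convert card_filter_lt_card_collisions_le hβ0 hJK j
    · simp only [q, Fintype.sum_prod_type, Fintype.sum_sum_type, Finset.sum_const,
        Finset.card_univ, nsmul_eq_mul, Fintype.card_fin, Fintype.card_unit, Nat.cast_one]
      linarith
  have hGV : ∀ s j, ∑ k, KLdiv (Zout Φ (Vfam s) (G j k)) (Q s) ≤ A := fun s j =>
    not_lt.1 (hG (j, .inl s))
  have hGW : ∀ s j, ∑ k, errProb (Wfam s) Φ ψ (G j k) ≤ B := fun s j =>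
    not_lt.1 (hG (j, .inr (.inl s)))
  have hGC : ∀ j, ((collisions G j).card : ℝ) ≤ K * (3 * β / 2) := fun j =>
    not_lt.1 (hG (j, .inr (.inr ())))
  have hc0 : 0 < (K : ℝ) * (1 - 3 * β / 2) := mul_pos hK' (by linarith)
  have hcard : ∀ j, (K : ℝ) * (1 - 3 * β / 2) ≤ ((collisions G j)ᶜ.card : ℝ) := by
    intro j
    have h := Finset.card_add_card_compl (collisions G j)
    rw [Fintype.card_fin] at h
    have h' : ((collisions G j).card : ℝ) + ((collisions G j)ᶜ.card : ℝ) = K := by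
      exact_mod_cast h
    linarith [hGC j]
  let w : Fin J → Fin K → ℝ := fun j k =>
    if k ∈ (collisions G j)ᶜ then ((collisions G j)ᶜ.card : ℝ)⁻¹ else 0
  have hw : ∀ j, IsProbDist (w j) := by
    intro j
    refine ⟨fun k => ?_, ?_⟩
    · simp only [w]
      split_ifs <;> positivity
    · simp only [w]
      rw [Finset.sum_ite_mem, Finset.univ_inter, Finset.sum_const, nsmul_eq_mul,
        mul_inv_cancel₀ (hc0.trans_le (hcard j)).ne']
  have hwle : ∀ j k, w j k ≤ ((K : ℝ) * (1 - 3 * β / 2))⁻¹ := by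
    intro j k
    simp only [w]
    split_ifs
    · exact inv_anti₀ hc0 (hcard j)
    · positivity
  have hwsum : ∀ j (f : Fin K → ℝ) (T : ℝ), (∀ k, 0 ≤ f k) → ∑ k, f k ≤ T →
      ∑ k, w j k * f k ≤ T / ((K : ℝ) * (1 - 3 * β / 2)) := by
    intro j f T hf hT
    rw [div_eq_inv_mul]
    refine le_trans ?_ (mul_le_mul_of_nonneg_left hT (inv_nonneg.2 hc0.le))
    rw [Finset.mul_sum]
    exact Finset.sum_le_sum fun k _ => mul_le_mul_of_nonneg_right (hwle j k) (hf k)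
  have hdec : ∀ y, ∃ j : Fin J, ∀ j' k, w j' k ≠ 0 → ψ y = G j' k → j = j' := by
    intro y
    by_cases h : ∃ j k, w j k ≠ 0 ∧ ψ y = G j k
    · obtain ⟨j, k, -, hy⟩ := h
      refine ⟨j, fun j' k' hw' hy' => ?_⟩
      by_contra hne
      simp only [w, ne_eq, ite_eq_right_iff, not_forall, Finset.mem_compl] at hw'
      exact hw'.1 (by
        simp only [collisions, Finset.mem_filter, Finset.mem_univ, true_and]
        exact ⟨j, hne, k, hy.symm.trans hy'⟩)
    · exact ⟨⟨0, hJ⟩, fun j' k hw' hy => (h ⟨j', k, hw', hy⟩).elim⟩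
  choose ν hν using hdec
  have hΥ : ∀ j, IsProbDist fun x => ∑ k, w j k * Φ (G j k) x := fun j =>
    (hw j).mix fun k => hΦ (G j k)
  refine ⟨fun j x => ∑ k, w j k * Φ (G j k) x, ν, hΥ, fun s j => ?_, fun s p hp => ?_⟩
  · exact (errProb_mix_le hΦ (hWchan s) (hw j).1 fun k y h1 h2 => hν y j k h1 h2).trans
      (hwsum j _ B (fun k => errProb_nonneg hΦ (hWchan s) ψ _) (hGW s j))
  · refine mutualInfo_le_of_KLdiv_le hp (isProbDist_Zout hΥ (hVchan s)) (hQ s) ?_ fun j => ?_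
    · intro j z hz
      simp [Zout_mix, hac s _ z hz]
    · rw [Zout_mix]
      exact (KLdiv_mix_le (hw j) (fun k => hZ s _) fun k => hac s _).trans
        (hwsum j _ A (fun k => hD0 s _) (hGV s j))


end
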